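/- Let F be a totally real number field of degree m with ring of integers O, and let n ≥ 1. Then there exists a totally positive α ∈ F such that the n-ary quadratic form f_α(x_1,…,x_n) = Tr_{F/ℚ}(α A_n(x_1,…,x_n)) over F is perfect. -/

import Mathlib

open NumberField

/-- The `n`-ary form `f_α(x₁,…,xₙ) = Tr_{F/ℚ}(α · A_n(x₁,…,xₙ))` on `(𝓞 F)ⁿ`,
where `A_n(x) = Σ_{1 ≤ i ≤ j ≤ n} x_i x_j`. -/
noncomputable def fAlpha (F : Type*) [Field F] [NumberField F] (n : ℕ) (α : F)
    (v : Fin n → RingOfIntegers F) : ℚ :=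
  Algebra.trace ℚ F (α * ∑ i, ∑ j ∈ Finset.Ici i, (v i : F) * (v j : F))

/-- `v` is a minimal vector for `f_α`: it is nonzero and attains the minimum of `f_α` on
`(𝓞 F)ⁿ ∖ {0}`. -/
def IsMinVec (F : Type*) [Field F] [NumberField F] (n : ℕ) (α : F)
    (v : Fin n → RingOfIntegers F) : Prop :=
  v ≠ 0 ∧ ∀ w : Fin n → RingOfIntegers F, w ≠ 0 → fAlpha F n α v ≤ fAlpha F n α w

section helpers

variable {F : Type*} [Field F] [NumberField F]

/-- The unary form `Tr(α w²)`. -/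
noncomputable def unaryQ (α : F) (w : 𝓞 F) : ℚ := Algebra.trace ℚ F (α * (w : F) ^ 2)

/-- Minimal vectors of the unary form. -/
def unaryMin (α : F) : Set (𝓞 F) :=
  {u | u ≠ 0 ∧ ∀ w : 𝓞 F, w ≠ 0 → unaryQ α u ≤ unaryQ α w}

/-- Span of the squares of the minimal vectors. -/
noncomputable def minSpan (α : F) : Submodule ℚ F :=
  Submodule.span ℚ ((fun u : 𝓞 F => (u : F) ^ 2) '' unaryMin α)

theorem embIsReal (hreal : ∀ v : InfinitePlace F, v.IsReal) (φ : F →+* ℂ) :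
    ComplexEmbedding.IsReal φ := InfinitePlace.isReal_mk_iff.mp (hreal (InfinitePlace.mk φ))

/-- Real embeddings are the complex embeddings. -/
theorem embBij (hreal : ∀ v : InfinitePlace F, v.IsReal) :
    Function.Bijective (fun σ : F →+* ℝ => (Complex.ofRealHom.comp σ : F →+* ℂ)) := by
  constructor
  · intro σ τ h
    ext x
    have := RingHom.congr_fun h x
    simpa using this
  · intro φ
    refine ⟨(embIsReal hreal φ).embedding, ?_⟩
    ext x
    simp

theorem trace_real (hreal : ∀ v : InfinitePlace F, v.IsReal) (x : F) :
    ((Algebra.trace ℚ F x : ℚ) : ℝ) = ∑ σ : F →+* ℝ, σ x := by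
  have h1 := trace_eq_sum_embeddings (K := ℚ) (L := F) ℂ (x := x)
  have h2 : ∑ σ : F →ₐ[ℚ] ℂ, σ x = ∑ φ : F →+* ℂ, φ x :=
    (Fintype.sum_equiv (RingHom.equivRatAlgHom F ℂ) (fun f => f x) (fun φ => φ x)
      (fun _ => by simp [RingHom.equivRatAlgHom_apply])).symm
  have h3 := (embBij hreal).sum_comp (fun φ : F →+* ℂ => φ x)
  rw [h2, ← h3] at h1
  apply Complex.ofReal_injective
  simpa using h1

theorem unaryQ_real (hreal : ∀ v : InfinitePlace F, v.IsReal) (α : F) (w : 𝓞 F) :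
    (unaryQ α w : ℝ) = ∑ σ : F →+* ℝ, σ α * σ (w : F) ^ 2 := by
  rw [unaryQ, trace_real hreal]
  simp

theorem exists_realEmb (hreal : ∀ v : InfinitePlace F, v.IsReal) : Nonempty (F →+* ℝ) := by
  obtain ⟨φ⟩ : Nonempty (F →+* ℂ) := inferInstance
  exact ⟨(embIsReal hreal φ).embedding⟩

theorem exists_small (hreal : ∀ v : InfinitePlace F, v.IsReal) (σ₀ : F →+* ℝ) (ε : ℝ)
    (hε : 0 < ε) : ∃ w : 𝓞 F, w ≠ 0 ∧ ∀ σ : F →+* ℝ, σ ≠ σ₀ → |σ (w : F)| < ε := by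
  obtain ⟨u, hu⟩ := Units.dirichletUnitTheorem.exists_unit F
    (InfinitePlace.mk (Complex.ofRealHom.comp σ₀))
  have hlt : ∀ σ : F →+* ℝ, σ ≠ σ₀ → |σ ((u : 𝓞 F) : F)| < 1 := by
    intro σ hσ
    have hne : InfinitePlace.mk (Complex.ofRealHom.comp σ) ≠
        InfinitePlace.mk (Complex.ofRealHom.comp σ₀) := by
      intro h
      rw [InfinitePlace.mk_eq_iff] at h
      rcases h with h | h
      · exact hσ ((embBij hreal).1 h)
      · rw [ComplexEmbedding.isReal_iff.mp (embIsReal hreal _)] at h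
        exact hσ ((embBij hreal).1 h)
    have h := hu _ hne
    have h0 : (InfinitePlace.mk (Complex.ofRealHom.comp σ)) ((u : 𝓞 F) : F) =
        |σ ((u : 𝓞 F) : F)| := by
      simp [InfinitePlace.apply]
    rw [h0] at h
    by_contra hcon
    exact absurd (Real.log_nonneg (not_lt.mp hcon)) (not_le.mpr h)
  have hk : ∀ σ : F →+* ℝ, ∃ N : ℕ, ∀ k ≥ N, σ ≠ σ₀ → |σ ((u : 𝓞 F) : F)| ^ k < ε := by
    intro σ
    by_cases hσ : σ = σ₀
    · exact ⟨0, fun k _ h => absurd hσ h⟩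
    · have := (tendsto_pow_atTop_nhds_zero_of_lt_one (abs_nonneg _)
        (hlt σ hσ)).eventually_lt_const hε
      obtain ⟨N, hN⟩ := Filter.eventually_atTop.mp this
      exact ⟨N, fun k hk _ => hN k hk⟩
  choose N hN using hk
  refine ⟨(u : 𝓞 F) ^ (∑ σ, N σ), pow_ne_zero _ u.ne_zero, fun σ hσ => ?_⟩
  have := hN σ (∑ σ, N σ) (Finset.single_le_sum (f := N) (fun _ _ => Nat.zero_le _)
    (Finset.mem_univ σ)) hσ
  simpa [abs_pow] using this

theorem finite_le (hreal : ∀ v : InfinitePlace F, v.IsReal) (α : F)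
    (hα : ∀ σ : F →+* ℝ, 0 < σ α) (C : ℚ) : {w : 𝓞 F | unaryQ α w ≤ C}.Finite := by
  have hb : ∀ σ : F →+* ℝ, ∀ w : 𝓞 F, unaryQ α w ≤ C → |σ (w : F)| ≤ (C : ℝ) / σ α + 1 := by
    intro σ w hw
    have h1 : (unaryQ α w : ℝ) ≤ C := by exact_mod_cast hw
    rw [unaryQ_real hreal] at h1
    have h2 : σ α * σ (w : F) ^ 2 ≤ ∑ σ : F →+* ℝ, σ α * σ (w : F) ^ 2 :=
      Finset.single_le_sum (f := fun σ : F →+* ℝ => σ α * σ (w : F) ^ 2)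
        (fun τ _ => mul_nonneg (hα τ).le (sq_nonneg _)) (Finset.mem_univ σ)
    have h3 : σ (w : F) ^ 2 ≤ (C : ℝ) / σ α := by
      rw [le_div_iff₀ (hα σ)]; linarith
    have h4 := sq_abs (σ (w : F))
    nlinarith [sq_nonneg (|σ (w : F)| - 1), abs_nonneg (σ (w : F))]
  have hfin := Embeddings.finite_of_norm_le F ℂ (∑ σ : F →+* ℝ, |(C : ℝ) / σ α + 1|)
  refine (hfin.preimage (f := fun w : 𝓞 F => (w : F))
    (RingOfIntegers.coe_injective.injOn)).subset ?_
  intro w hw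
  refine ⟨w.isIntegral_coe, fun φ => ?_⟩
  obtain ⟨σ, rfl⟩ := (embBij hreal).2 φ
  have h := hb σ w hw
  have h2 : |(C : ℝ) / σ α + 1| ≤ ∑ σ : F →+* ℝ, |(C : ℝ) / σ α + 1| :=
    Finset.single_le_sum (f := fun σ : F →+* ℝ => |(C : ℝ) / σ α + 1|)
      (fun τ _ => abs_nonneg _) (Finset.mem_univ σ)
  have h3 := le_abs_self ((C : ℝ) / σ α + 1)
  simp only [RingHom.comp_apply, Complex.ofRealHom_eq_coe, Complex.norm_real, Real.norm_eq_abs]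
  linarith

theorem unaryQ_pos (hreal : ∀ v : InfinitePlace F, v.IsReal) (α : F)
    (hα : ∀ σ : F →+* ℝ, 0 < σ α) (w : 𝓞 F) (hw : w ≠ 0) : 0 < unaryQ α w := by
  have : (0 : ℝ) < unaryQ α w := by
    rw [unaryQ_real hreal]
    obtain ⟨σ⟩ := exists_realEmb hreal
    have hne : ∀ τ : F →+* ℝ, τ (w : F) ≠ 0 := fun τ => by simpa using hw
    exact Finset.sum_pos (fun τ _ => mul_pos (hα τ) (sq_pos_of_ne_zero (hne τ))) ⟨σ, Finset.mem_univ _⟩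
  exact_mod_cast this

theorem exists_min (hreal : ∀ v : InfinitePlace F, v.IsReal) (α : F)
    (hα : ∀ σ : F →+* ℝ, 0 < σ α) : (unaryMin α).Nonempty := by
  have hf : {w : 𝓞 F | w ≠ 0 ∧ unaryQ α w ≤ unaryQ α 1}.Finite :=
    (finite_le hreal α hα (unaryQ α 1)).subset fun w hw => hw.2
  obtain ⟨u, hu, hmin⟩ := Set.exists_min_image _ (unaryQ α) hf ⟨1, one_ne_zero, le_rfl⟩
  refine ⟨u, hu.1, fun w hw => ?_⟩
  by_cases h : unaryQ α w ≤ unaryQ α 1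
  · exact hmin w ⟨hw, h⟩
  · exact hu.2.trans (not_le.mp h).le

theorem unaryQ_add (α β : F) (t : ℚ) (w : 𝓞 F) :
    unaryQ (α + t • β) w = unaryQ α w + t * unaryQ β w := by
  simp only [unaryQ]
  rw [add_mul, smul_mul_assoc, map_add, map_smul, smul_eq_mul]

theorem emb_add (α β : F) (t : ℚ) (σ : F →+* ℝ) : σ (α + t • β) = σ α + t * σ β := by
  rw [map_add, Rat.smul_def, map_mul, map_ratCast]

/-- The Voronoi step. -/
theorem step (hreal : ∀ v : InfinitePlace F, v.IsReal) (α β : F)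
    (hα : ∀ σ : F →+* ℝ, 0 < σ α) (hneg : ∃ σ : F →+* ℝ, σ β < 0)
    (hβ : ∀ u ∈ unaryMin α, unaryQ β u = 0) :
    ∃ α' : F, (∀ σ : F →+* ℝ, 0 < σ α') ∧ unaryMin α ⊆ unaryMin α' ∧
      ∃ w ∈ unaryMin α', unaryQ β w < 0 := by
  classical
  obtain ⟨u₀, hu₀⟩ := exists_min hreal α hα
  set m := unaryQ α u₀ with hm
  have hm0 : 0 < m := unaryQ_pos hreal α hα u₀ hu₀.1
  have hmin : ∀ u ∈ unaryMin α, unaryQ α u = m := fun u hu =>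
    le_antisymm (hu.2 _ hu₀.1) (hu₀.2 _ hu.1)
  -- first time an embedding vanishes
  obtain ⟨σ₁, hσ₁⟩ := hneg
  obtain ⟨σ₀, hσ₀, hT⟩ := Finset.exists_min_image
    (Finset.univ.filter fun σ : F →+* ℝ => σ β < 0) (fun σ => σ α / (-σ β))
    ⟨σ₁, by simpa using hσ₁⟩
  have hσ₀' : σ₀ β < 0 := by simpa using hσ₀
  set T : ℝ := σ₀ α / (-σ₀ β) with hTdef
  have hTpos : 0 < T := div_pos (hα _) (by linarith)
  have hy : ∀ σ : F →+* ℝ, 0 ≤ σ α + T * σ β := by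
    intro σ
    by_cases h : σ β < 0
    · have := hT σ (by simpa using h)
      rw [le_div_iff₀ (by linarith)] at this
      linarith
    · have := mul_nonneg hTpos.le (not_lt.mp h)
      linarith [hα σ]
  have hy0 : σ₀ α + T * σ₀ β = 0 := by
    have : σ₀ β ≠ 0 := hσ₀'.ne
    rw [hTdef]; field_simp; ring
  set S : ℝ := ∑ σ : F →+* ℝ, (σ α + T * σ β) with hS
  have hS0 : 0 ≤ S := Finset.sum_nonneg fun σ _ => hy σ
  have hmR : (0 : ℝ) < m := by exact_mod_cast hm0
  obtain ⟨w₀, hw₀, hsmall⟩ := exists_small hreal σ₀ (min 1 (m / (S + 1)))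
    (lt_min one_pos (by positivity))
  have hw₀T : (unaryQ α w₀ : ℝ) + T * unaryQ β w₀ < m := by
    rw [unaryQ_real hreal, unaryQ_real hreal, Finset.mul_sum, ← Finset.sum_add_distrib]
    have : ∑ σ : F →+* ℝ, (σ α * σ (w₀ : F) ^ 2 + T * (σ β * σ (w₀ : F) ^ 2)) ≤
        ∑ σ : F →+* ℝ, (σ α + T * σ β) * (m / (S + 1)) := by
      refine Finset.sum_le_sum fun σ _ => ?_
      have e : σ α * σ (w₀ : F) ^ 2 + T * (σ β * σ (w₀ : F) ^ 2) =
        (σ α + T * σ β) * σ (w₀ : F) ^ 2 := by ring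
      rw [e]
      by_cases h : σ = σ₀
      · subst h; rw [hy0]; simp
      · refine mul_le_mul_of_nonneg_left ?_ (hy σ)
        have h1 := hsmall σ h
        have h2 := h1.trans_le (min_le_left _ _)
        have h3 := h1.trans_le (min_le_right _ _)
        have h4 := sq_abs (σ (w₀ : F))
        nlinarith [abs_nonneg (σ (w₀ : F))]
    refine this.trans_lt ?_
    rw [← Finset.sum_mul, ← hS, ← mul_div_assoc, div_lt_iff₀ (by linarith)]
    linarith
  have hαm : ∀ w : 𝓞 F, w ≠ 0 → m ≤ unaryQ α w := hu₀.2
  have hβw₀ : unaryQ β w₀ < 0 := by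
    by_contra h
    have h1 : (0 : ℝ) ≤ unaryQ β w₀ := by exact_mod_cast not_lt.mp h
    have h2 : (m : ℝ) ≤ unaryQ α w₀ := by exact_mod_cast hαm w₀ hw₀
    have := mul_nonneg hTpos.le h1
    linarith
  let t : 𝓞 F → ℚ := fun w => (unaryQ α w - m) / (-unaryQ β w)
  have ht : ∀ w, unaryQ β w < 0 → unaryQ α w + t w * unaryQ β w = m := by
    intro w hw
    have : unaryQ β w ≠ 0 := hw.ne
    simp only [t]; field_simp; ring
  have htnn : ∀ w, w ≠ 0 → unaryQ β w < 0 → 0 ≤ t w := fun w hw hw' =>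
    div_nonneg (by linarith [hαm w hw]) (by linarith)
  have ht₀T : ((t w₀ : ℚ) : ℝ) < T := by
    have h1 : (unaryQ α w₀ : ℝ) + t w₀ * unaryQ β w₀ = m := by exact_mod_cast ht w₀ hβw₀
    have h2 : (unaryQ β w₀ : ℝ) < 0 := by exact_mod_cast hβw₀
    by_contra h
    nlinarith [not_lt.mp h]
  have hpos : ∀ s : ℚ, 0 ≤ s → s ≤ t w₀ → ∀ σ : F →+* ℝ, 0 < σ (α + s • β) := by
    intro s hs hs' σ
    rw [emb_add]
    have h1 : (0 : ℝ) ≤ s := by exact_mod_cast hs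
    have h2 : (s : ℝ) ≤ t w₀ := by exact_mod_cast hs'
    have h3 := hα σ
    by_cases h : σ β < 0
    · nlinarith [hy σ]
    · nlinarith [not_lt.mp h]
  have hfin : {w : 𝓞 F | w ≠ 0 ∧ unaryQ β w < 0 ∧ unaryQ (α + t w₀ • β) w ≤ m}.Finite :=
    (finite_le hreal _ (hpos _ (htnn _ hw₀ hβw₀) le_rfl) m).subset fun w hw => hw.2.2
  have hw₀mem : w₀ ∈ {w : 𝓞 F | w ≠ 0 ∧ unaryQ β w < 0 ∧ unaryQ (α + t w₀ • β) w ≤ m} :=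
    ⟨hw₀, hβw₀, by rw [unaryQ_add, ht _ hβw₀]⟩
  obtain ⟨w₁, hw₁, hw₁min⟩ := Set.exists_min_image _ t hfin ⟨w₀, hw₀mem⟩
  have hle := hw₁min w₀ hw₀mem
  have hnn := htnn w₁ hw₁.1 hw₁.2.1
  have hbound : ∀ w : 𝓞 F, w ≠ 0 → m ≤ unaryQ (α + t w₁ • β) w := by
    intro w hw
    rw [unaryQ_add]
    have h1 := hαm w hw
    by_cases hb : unaryQ β w < 0
    · by_cases hc : unaryQ (α + t w₀ • β) w ≤ m
      · have h2 := hw₁min w ⟨hw, hb, hc⟩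
        have h3 := ht w hb
        nlinarith
      · rw [unaryQ_add] at hc
        nlinarith [not_le.mp hc]
    · have := mul_nonneg hnn (not_lt.mp hb)
      linarith
  refine ⟨α + t w₁ • β, hpos _ hnn hle, ?_, w₁, ⟨hw₁.1, fun w hw => ?_⟩, hw₁.2.1⟩
  · intro u hu
    refine ⟨hu.1, fun w hw => ?_⟩
    rw [unaryQ_add, hβ u hu, hmin u hu, mul_zero, add_zero]
    exact hbound w hw
  · rw [unaryQ_add α β (t w₁) w₁, ht w₁ hw₁.2.1]
    exact hbound w hw

theorem exists_perfect_unary (hreal : ∀ v : InfinitePlace F, v.IsReal) :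
    ∃ α : F, (∀ σ : F →+* ℝ, 0 < σ α) ∧ minSpan α = ⊤ := by
  obtain ⟨W, ⟨α, hα, rfl⟩, hmax⟩ := wellFounded_gt.has_min
    {W : Submodule ℚ F | ∃ α : F, (∀ σ : F →+* ℝ, 0 < σ α) ∧ minSpan α = W}
    ⟨_, 1, fun σ => by simp, rfl⟩
  refine ⟨α, hα, ?_⟩
  by_contra hne
  obtain ⟨f, hf0, hf⟩ := Submodule.exists_le_ker_of_lt_top _ (lt_top_iff_ne_top.mpr hne)
  set β₀ := ((Algebra.traceForm ℚ F).toDual (traceForm_nondegenerate ℚ F)).symm f with hβ₀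
  have hβf : ∀ x, Algebra.trace ℚ F (β₀ * x) = f x := by
    intro x
    have := LinearMap.BilinForm.apply_toDual_symm_apply
      (hB := traceForm_nondegenerate ℚ F) f x
    rw [← this, Algebra.traceForm_apply]
  have hβ0 : β₀ ≠ 0 := by
    intro h
    apply hf0
    ext x
    rw [← hβf, h]; simp
  obtain ⟨σ⟩ := exists_realEmb hreal
  obtain ⟨β, hneg, c, hc⟩ : ∃ β : F, (∃ σ : F →+* ℝ, σ β < 0) ∧
      ∃ c : ℚ, ∀ x, Algebra.trace ℚ F (β * x) = c * f x := by
    have : σ β₀ ≠ 0 := by simpa using hβ0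
    rcases lt_or_gt_of_ne this with h | h
    · exact ⟨β₀, ⟨σ, h⟩, 1, fun x => by rw [hβf, one_mul]⟩
    · exact ⟨-β₀, ⟨σ, by simpa using h⟩, -1, fun x => by rw [neg_mul, map_neg, hβf]; ring⟩
  have hker : ∀ x ∈ minSpan α, Algebra.trace ℚ F (β * x) = 0 := by
    intro x hx
    have : f x = 0 := hf hx
    rw [hc, this, mul_zero]
  obtain ⟨α', hα', hsub, w, hw, hwneg⟩ := step hreal α β hα hneg (fun u hu =>
    hker _ (Submodule.subset_span ⟨u, hu, rfl⟩))
  refine hmax (minSpan α') ⟨α', hα', rfl⟩ ?_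
  refine lt_of_le_of_ne (Submodule.span_mono (Set.image_mono hsub)) ?_
  intro heq
  have h1 : (w : F) ^ 2 ∈ minSpan α := by
    rw [heq]; exact Submodule.subset_span ⟨w, hw, rfl⟩
  have h2 := hker _ h1
  rw [unaryQ] at hwneg
  linarith

theorem eq_of_trace (α : F) (hspan : minSpan α = ⊤) (β : F)
    (h : ∀ u ∈ unaryMin α, unaryQ β u = unaryQ α u) : β = α := by
  have key : ∀ x : F, Algebra.trace ℚ F ((β - α) * x) = 0 := by
    intro x
    have hx : x ∈ minSpan α := by rw [hspan]; trivial
    induction hx using Submodule.span_induction with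
    | mem x hx =>
      obtain ⟨u, hu, rfl⟩ := hx
      have := h u hu
      simp only [unaryQ] at this
      simp only [sub_mul, map_sub, this, sub_self]
    | zero => simp
    | add x y _ _ hx hy => rw [mul_add, map_add, hx, hy, add_zero]
    | smul c x _ hx => rw [mul_smul_comm, map_smul, hx, smul_zero]
  exact sub_eq_zero.mp ((traceForm_nondegenerate ℚ F).1 (β - α) key)

theorem two_mul_form {R : Type*} [CommRing R] (n : ℕ) (x : Fin n → R) :
    2 * ∑ i, ∑ j ∈ Finset.Ici i, x i * x j = ∑ i, x i ^ 2 + (∑ i, x i) ^ 2 := by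
  have h1 : ∑ i, ∑ j ∈ Finset.Ici i, x i * x j = ∑ i, ∑ j, if i ≤ j then x i * x j else 0 := by
    refine Finset.sum_congr rfl fun i _ => ?_
    rw [← Finset.sum_filter]
    refine Finset.sum_congr ?_ fun _ _ => rfl
    ext j; simp
  have h2 : ∑ i, ∑ j, (if i ≤ j then x i * x j else 0) =
      ∑ i, ∑ j, if j ≤ i then x i * x j else 0 := by
    rw [Finset.sum_comm]
    simp only [mul_comm]
  have h3 : ∑ i, x i ^ 2 = ∑ i, ∑ j, if i = j then x i * x j else 0 := by
    simp [sq]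
  rw [two_mul, h1]
  nth_rewrite 2 [h2]
  rw [h3, sq (∑ i, x i), Finset.sum_mul_sum, ← Finset.sum_add_distrib, ← Finset.sum_add_distrib]
  refine Finset.sum_congr rfl fun i _ => ?_
  rw [← Finset.sum_add_distrib, ← Finset.sum_add_distrib]
  refine Finset.sum_congr rfl fun j _ => ?_
  rcases lt_trichotomy i j with h | h | h
  · simp [h.le, h.ne, not_le.mpr h]
  · simp [h]
  · simp [h.le, h.ne', not_le.mpr h]

theorem two_mul_fAlpha (n : ℕ) (α : F) (v : Fin n → 𝓞 F) :
    2 * fAlpha F n α v = ∑ i, unaryQ α (v i) + unaryQ α (∑ i, v i) := by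
  have h := two_mul_form n (fun i => (v i : F))
  have e : α * (2 * ∑ i, ∑ j ∈ Finset.Ici i, (v i : F) * (v j : F)) =
      (2 : ℚ) • (α * ∑ i, ∑ j ∈ Finset.Ici i, (v i : F) * (v j : F)) := by
    rw [Rat.smul_def]; push_cast; ring
  have h' := congrArg (fun z => Algebra.trace ℚ F (α * z)) h
  simp only [e, map_smul, smul_eq_mul] at h'
  rw [fAlpha, h', mul_add, map_add, Finset.mul_sum, map_sum]
  simp [unaryQ]

theorem unaryQ_zero (α : F) : unaryQ α 0 = 0 := by simp [unaryQ]

theorem unaryQ_neg (α : F) (w : 𝓞 F) : unaryQ α (-w) = unaryQ α w := by simp [unaryQ]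

theorem fAlpha_lower (hreal : ∀ v : InfinitePlace F, v.IsReal) (n : ℕ) (α : F)
    (hα : ∀ σ : F →+* ℝ, 0 < σ α) (u : 𝓞 F) (hu : u ∈ unaryMin α) (v : Fin n → 𝓞 F)
    (hv : v ≠ 0) : unaryQ α u ≤ fAlpha F n α v := by
  classical
  have h2 := two_mul_fAlpha n α v
  have hnn : ∀ w : 𝓞 F, 0 ≤ unaryQ α w := fun w => by
    by_cases h : w = 0
    · rw [h, unaryQ_zero]
    · exact (unaryQ_pos hreal α hα w h).le
  obtain ⟨i, hi⟩ := Function.ne_iff.mp hv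
  have hi' : v i ≠ 0 := hi
  have h3 := hu.2 _ hi'
  by_cases hs : ∑ i, v i = 0
  · obtain ⟨j, hj, hj0⟩ : ∃ j, j ≠ i ∧ v j ≠ 0 := by
      by_contra hcon
      push Not at hcon
      rw [Finset.sum_eq_single i (fun j _ hj => hcon j hj) (by simp)] at hs
      exact hi' hs
    have h4 := hu.2 _ hj0
    have h5 : ∑ k ∈ {i, j}, unaryQ α (v k) ≤ ∑ k, unaryQ α (v k) :=
      Finset.sum_le_sum_of_subset_of_nonneg (Finset.subset_univ _) (fun k _ _ => hnn _)
    rw [Finset.sum_pair hj.symm] at h5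
    linarith [hnn (∑ i, v i)]
  · have h4 := hu.2 _ hs
    have h5 := Finset.single_le_sum (f := fun k => unaryQ α (v k)) (fun k _ => hnn _)
      (Finset.mem_univ i)
    linarith

theorem fAlpha_single (n : ℕ) (α : F) (u : 𝓞 F) (i : Fin n) :
    fAlpha F n α (Pi.single i u) = unaryQ α u := by
  classical
  have h := two_mul_fAlpha n α (Pi.single i u)
  rw [Finset.sum_pi_single', if_pos (Finset.mem_univ i),
    Finset.sum_eq_single i (fun j _ hj => by rw [Pi.single_eq_of_ne hj, unaryQ_zero])
      (by simp), Pi.single_eq_same] at h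
  linarith

theorem fAlpha_pair (n : ℕ) (α : F) (u : 𝓞 F) (i j : Fin n) (hij : i ≠ j) :
    fAlpha F n α (Pi.single i u - Pi.single j u) = unaryQ α u := by
  classical
  have h := two_mul_fAlpha n α (Pi.single i u - Pi.single j u)
  have hs : ∑ k, (Pi.single i u - Pi.single j u : Fin n → 𝓞 F) k = 0 := by
    simp [Finset.sum_sub_distrib]
  rw [hs, unaryQ_zero, Fintype.sum_eq_add i j hij ?_] at h
  · simp [hij, hij.symm, unaryQ_neg] at h
    linarith
  · rintro k ⟨hk, hk'⟩
    simp [hk, hk', unaryQ_zero]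

end helpers

/-- Let `F` be a totally real number field and `n ≥ 1`.  Then there exists a totally
positive `α ∈ F` such that `f_α(x) = Tr_{F/ℚ}(α A_n(x))` is a perfect form over `F`:
there is a unique symmetric `n × n` matrix `X` over `F` with
`Tr_{F/ℚ}(vᵗ X v) = m(f_α)` for all minimal vectors `v` of `f_α`. -/
theorem exists_totallyPositive_fAlpha_perfect
    (F : Type*) [Field F] [NumberField F]
    (hreal : ∀ v : InfinitePlace F, v.IsReal)
    (n : ℕ) (hn : 1 ≤ n) :
    ∃ α : F, (∀ σ : F →+* ℝ, 0 < σ α) ∧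
      ∃! X : Matrix (Fin n) (Fin n) F, X.IsSymm ∧
        ∀ v : Fin n → RingOfIntegers F, IsMinVec F n α v →
          Algebra.trace ℚ F (∑ i, ∑ j, (v i : F) * X i j * (v j : F)) = fAlpha F n α v := by
  classical
  obtain ⟨α, hα, hspan⟩ := exists_perfect_unary hreal
  refine ⟨α, hα, ?_⟩
  have hminS : ∀ u ∈ unaryMin α, ∀ i : Fin n, IsMinVec F n α (Pi.single i u) := by
    intro u hu i
    refine ⟨by simpa using hu.1, fun w hw => ?_⟩
    rw [fAlpha_single]
    exact fAlpha_lower hreal n α hα u hu w hw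
  have hminP : ∀ u ∈ unaryMin α, ∀ i j : Fin n, i ≠ j →
      IsMinVec F n α (Pi.single i u - Pi.single j u) := by
    intro u hu i j hij
    refine ⟨fun h => hu.1 ?_, fun w hw => ?_⟩
    · simpa [hij] using congrFun h i
    · rw [fAlpha_pair n α u i j hij]
      exact fAlpha_lower hreal n α hα u hu w hw
  refine ⟨Matrix.of fun i j => α / 2 + if i = j then α / 2 else 0, ⟨?_, ?_⟩, ?_⟩
  · ext i j
    simp [Matrix.transpose_apply, eq_comm]
  · intro v _
    rw [fAlpha]
    congr 1
    have h := two_mul_form n (fun k => (v k : F))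
    have e : ∑ i, ∑ j ∈ Finset.Ici i, (v i : F) * (v j : F) =
        (∑ i, (v i : F) ^ 2 + (∑ i, (v i : F)) ^ 2) / 2 := by
      rw [← h]; field_simp
    rw [e]
    simp only [Matrix.of_apply, mul_add, add_mul, Finset.sum_add_distrib]
    have e1 : ∑ i, ∑ j, (v i : F) * (α / 2) * (v j : F) = α / 2 * (∑ i, (v i : F)) ^ 2 := by
      rw [sq, Finset.sum_mul_sum, Finset.mul_sum]
      refine Finset.sum_congr rfl fun i _ => ?_
      rw [Finset.mul_sum]
      exact Finset.sum_congr rfl fun j _ => by ring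
    have e2 : ∑ i, ∑ j, (v i : F) * (if i = j then α / 2 else 0) * (v j : F) =
        α / 2 * ∑ i, (v i : F) ^ 2 := by
      rw [Finset.mul_sum]
      refine Finset.sum_congr rfl fun i _ => ?_
      rw [Finset.sum_eq_single i (fun j _ hj => by simp [hj.symm]) (by simp)]
      simp; ring
    rw [e1, e2]; ring
  · rintro Y ⟨hsym, hY⟩
    have hdiag : ∀ i, Y i i = α := by
      intro i
      apply eq_of_trace α hspan
      intro u hu
      have h := hY _ (hminS u hu i)
      rw [fAlpha_single] at h
      rw [← h, unaryQ]
      congr 1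
      rw [Finset.sum_eq_single i (fun j _ hj => by simp [hj]) (by simp),
        Finset.sum_eq_single i (fun j _ hj => by simp [hj]) (by simp)]
      simp; ring
    have hoff : ∀ i j, i ≠ j → Y i i - 2 * Y i j + Y j j = α := by
      intro i j hij
      apply eq_of_trace α hspan
      intro u hu
      have h := hY _ (hminP u hu i j hij)
      rw [fAlpha_pair n α u i j hij] at h
      rw [← h, unaryQ]
      congr 1
      have hs : Y j i = Y i j := hsym.apply i j
      rw [Fintype.sum_eq_add i j hij (fun k hk => by simp [hk.1, hk.2]),
        Fintype.sum_eq_add i j hij (fun k hk => by simp [hk.1, hk.2]),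
        Fintype.sum_eq_add i j hij (fun k hk => by simp [hk.1, hk.2])]
      simp [hij, hij.symm, hs]; ring
    ext i j
    by_cases hij : i = j
    · subst hij
      simp [hdiag]
    · have h := hoff i j hij
      rw [hdiag, hdiag] at h
      simp only [Matrix.of_apply, hij, if_false, add_zero]
      linear_combination (-1 / 2 : F) * h
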